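/- Let α = (φ,σ) be a minimal action of the infinite dihedral group ℤ⋊ℤ₂ on a Cantor set X. Then the ℤ-action induced by φ is free: if φⁿ(x) = x for some x ∈ X and n ∈ ℤ, then n = 0. -/

import Mathlib

/-- A point fixed by a nonzero power of a permutation has a finite orbit. -/
theorem Equiv.Perm.finite_range_zpow_apply {X : Type*} (g : Equiv.Perm X) {n : ℤ} (hn : n ≠ 0)
    {x : X} (hx : (g ^ n) x = x) : (Set.range fun m : ℤ => (g ^ m) x).Finite := by
  refine ((Set.finite_Ico (0 : ℤ) |n|).image fun m => (g ^ m) x).subset ?_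
  rintro _ ⟨m, rfl⟩
  refine ⟨m % n, ⟨Int.emod_nonneg m hn, Int.emod_lt_abs m hn⟩, ?_⟩
  have hk : (g ^ (n * (m / n))) x = x := by
    rw [zpow_mul]
    exact Equiv.Perm.zpow_apply_eq_self_of_apply_eq_self hx _
  change (g ^ (m % n)) x = (g ^ m) x
  conv_rhs => rw [← Int.emod_add_mul_ediv m n, zpow_add, Equiv.Perm.mul_apply, hk]

/-- If an involution `s` inverts `g`, then it preserves the set of fixed points of each power
of `g`. -/
theorem Equiv.Perm.zpow_apply_involution_eq {X : Type*} (g s : Equiv.Perm X)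
    (hs : ∀ x, s (s x) = x) (hrel : ∀ x, s (g (s x)) = g⁻¹ x) {n : ℤ} {x : X}
    (hx : (g ^ n) x = x) : (g ^ n) (s x) = s x := by
  have hinv : s⁻¹ = s := by
    ext y
    rw [Equiv.Perm.inv_eq_iff_eq, hs]
  have hconj : s * g * s⁻¹ = g⁻¹ := by
    rw [hinv]
    ext y
    exact hrel y
  have hpow : s * g ^ n * s⁻¹ = (g ^ n)⁻¹ := by
    rw [← conj_zpow, hconj, inv_zpow]
  have h := congrArg (fun f : Equiv.Perm X => f (s x)) hpow
  simp only [hinv, Equiv.Perm.mul_apply, hs, hx] at h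
  exact (Equiv.Perm.inv_eq_iff_eq.mp h.symm).symm

/-- Let `α = (φ, σ)` be a minimal action of the infinite dihedral group `ℤ ⋊ ℤ₂` on a Cantor
set `X` (so `σ² = id`, `σφσ = φ⁻¹` and every `α`-orbit is dense).  Then the `ℤ`-action
induced by `φ` is free: `φⁿ x = x` implies `n = 0`. -/
theorem dihedral_minimal_phi_free {X : Type*} [TopologicalSpace X] [CompactSpace X]
    [TopologicalSpace.MetrizableSpace X] [TotallyDisconnectedSpace X] [PerfectSpace X]
    [Nonempty X] (φ σ : X ≃ₜ X)
    (hσ : ∀ x, σ (σ x) = x) (hrel : ∀ x, σ (φ (σ x)) = φ.symm x)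
    (hmin : ∀ x : X,
      Dense {y : X | ∃ (n : ℤ) (i : Bool), y = (φ.toEquiv ^ n) (cond i (σ x) x)}) :
    ∀ (n : ℤ) (x : X), (φ.toEquiv ^ n) x = x → n = 0 := by
  intro n x hx
  by_contra hn
  have hσx : (φ.toEquiv ^ n) (σ x) = σ x :=
    Equiv.Perm.zpow_apply_involution_eq φ.toEquiv σ.toEquiv hσ hrel hx
  have hfin : {y : X | ∃ (n : ℤ) (i : Bool),
      y = (φ.toEquiv ^ n) (cond i (σ x) x)}.Finite := by
    refine ((Equiv.Perm.finite_range_zpow_apply φ.toEquiv hn hx).union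
      (Equiv.Perm.finite_range_zpow_apply φ.toEquiv hn hσx)).subset ?_
    rintro _ ⟨m, i, rfl⟩
    cases i
    · exact Or.inl ⟨m, rfl⟩
    · exact Or.inr ⟨m, rfl⟩
  have huniv := (hmin x).closure_eq
  rw [hfin.isClosed.closure_eq] at huniv
  rw [huniv] at hfin
  exact infinite_of_mem_nhds x Filter.univ_mem hfin
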